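/- Let T denote the Hecke operator T_1 acting on V(z_1) ⊗ V(z_2) ≅ V^{⊗2} ⊗ 𝕂[z_1^{±1}, z_2^{±1}], and define the coproduct operators Δ(E_i) = E_i ⊗ K_i + 1 ⊗ E_i, Δ(F_i) = F_i ⊗ 1 + K_i^{−1} ⊗ F_i, and Δ(K_i) = K_i ⊗ K_i, where in the first (respectively second) tensor slot the evaluation operators act in the variable z_1 (respectively z_2). Then for every i ∈ {0, 1, …, n−1}: T∘Δ(E_i) = Δ(E_i)∘T, T∘Δ(F_i) = Δ(F_i)∘T, and T∘Δ(K_i) = Δ(K_i)∘T. (This is the d = 2 case of the assertion that the Hecke algebra action centralizes the U_q(ŝl_n)-action on V(z_1) ⊗ ⋯ ⊗ V(z_d).) -/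

import Mathlib

/-!
STATEMENT 12. The Hecke operator `T = T_1` on `V(z_1) ⊗ V(z_2)` commutes with the coproduct
operators `Δ(E_i) = E_i ⊗ K_i + 1 ⊗ E_i`, `Δ(F_i) = F_i ⊗ 1 + K_i⁻¹ ⊗ F_i`,
`Δ(K_i) = K_i ⊗ K_i` of `U_q(ŝl_n)` (the `d = 2` case of the centralizer property).
`V` has basis `v_1, …, v_n`, indexed here by `b : Fin n ↦ v_{b+1}` (indices mod `n`,
`v_0 = v_n`); `V(z_1) ⊗ V(z_2)` is modeled as functions from the basis `Fin 2 → Fin n`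
of `V^{⊗2}` to the field `K` of rational functions in `z_1, z_2` (the fraction field of
`𝕂[z_1, z_2]`, in which `𝕂[z_1^{±1}, z_2^{±1}]` embeds and where the divisions in the
definition of `T` are available).  In the first (resp. second) tensor slot the evaluation
operators act in the variable `z_1` (resp. `z_2`).
-/

noncomputable section

open MvPolynomial

variable (𝕂 : Type*) [Field 𝕂] (q : 𝕂) (n : ℕ) [NeZero n]

/-- The field of rational functions in `z_1, z_2`. -/
abbrev KF := FractionRing (MvPolynomial (Fin 2) 𝕂)

/-- The variable `z_r` as a rational function. -/
def zvar (r : Fin 2) : KF 𝕂 := algebraMap (MvPolynomial (Fin 2) 𝕂) (KF 𝕂) (X r)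

/-- The scalar `q` as a rational function. -/
def qK : KF 𝕂 := algebraMap (MvPolynomial (Fin 2) 𝕂) (KF 𝕂) (C q)

/-- The field automorphism exchanging `z_1` and `z_2`. -/
def sSwap : KF 𝕂 ≃+* KF 𝕂 :=
  IsFractionRing.ringEquivOfRingEquiv
    (MvPolynomial.renameEquiv 𝕂 (Equiv.swap (0 : Fin 2) 1)).toRingEquiv

/-- `V(z_1) ⊗ V(z_2)`, as functions from the basis `Fin 2 → Fin n` of `V^{⊗2}` to the
coefficient field. -/
abbrev MS := (Fin 2 → Fin n) → KF 𝕂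

/-- The contribution of the basis tensor `v_{m_1} ⊗ v_{m_2}` with coefficient `f` to `T`. -/
def heckeContrib (m : Fin 2 → Fin n) (f : KF 𝕂) : MS 𝕂 n :=
  let f' := sSwap 𝕂 f
  let dpart := (zvar 𝕂 1 * f' - zvar 𝕂 0 * f) / (zvar 𝕂 0 - zvar 𝕂 1)
  let ppart := zvar 𝕂 0 * (f' - f) / (zvar 𝕂 0 - zvar 𝕂 1)
  if m 0 < m 1 then
    (-(qK 𝕂 q)) • Pi.single (m ∘ Equiv.swap (0 : Fin 2) 1) f'
      - ((qK 𝕂 q) ^ 2 - 1) • Pi.single m dpart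
  else if m 0 = m 1 then
    -(Pi.single m f') - ((qK 𝕂 q) ^ 2 - 1) • Pi.single m ppart
  else
    (-(qK 𝕂 q)) • Pi.single (m ∘ Equiv.swap (0 : Fin 2) 1) f'
      - ((qK 𝕂 q) ^ 2 - 1) • Pi.single m ppart

/-- The Hecke operator `T = T_1` on `V(z_1) ⊗ V(z_2)`. -/
def heckeT (ψ : MS 𝕂 n) : MS 𝕂 n :=
  ∑ m : Fin 2 → Fin n, heckeContrib 𝕂 q n m (ψ m)

/-- `E_i` acting in tensor slot `r` (in the variable `z_r`):
`E_i · (z^a v_j) = [i ≡ j-1 (mod n)] z^{a+δ_{i,0}} v_{j-1}`. -/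
def Eslot (i : Fin n) (r : Fin 2) (ψ : MS 𝕂 n) : MS 𝕂 n := fun m =>
  if m r = i - 1 then (if i = 0 then zvar 𝕂 r else 1) * ψ (Function.update m r (m r + 1)) else 0

/-- `F_i` acting in tensor slot `r` (in the variable `z_r`):
`F_i · (z^a v_j) = [i ≡ j (mod n)] z^{a-δ_{i,0}} v_{j+1}`. -/
def Fslot (i : Fin n) (r : Fin 2) (ψ : MS 𝕂 n) : MS 𝕂 n := fun m =>
  if m r = i then (if i = 0 then (zvar 𝕂 r)⁻¹ else 1) * ψ (Function.update m r (m r - 1)) else 0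

/-- `K_i` acting in tensor slot `r`:
`K_i · (z^a v_j) = q^{[i ≡ j (mod n)] - [i+1 ≡ j (mod n)]} z^a v_j`. -/
def Kslot (i : Fin n) (r : Fin 2) (ψ : MS 𝕂 n) : MS 𝕂 n := fun m =>
  (qK 𝕂 q) ^ (((if m r = i - 1 then 1 else 0) - (if m r = i then 1 else 0) : ℤ)) * ψ m

/-- `K_i⁻¹` acting in tensor slot `r`. -/
def Kinvslot (i : Fin n) (r : Fin 2) (ψ : MS 𝕂 n) : MS 𝕂 n := fun m =>
  (qK 𝕂 q) ^ (-((if m r = i - 1 then 1 else 0) - (if m r = i then 1 else 0) : ℤ)) * ψ m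

/-- `Δ(E_i) = E_i ⊗ K_i + 1 ⊗ E_i`. -/
def coprodE (i : Fin n) (ψ : MS 𝕂 n) : MS 𝕂 n :=
  Eslot 𝕂 n i 0 (Kslot 𝕂 q n i 1 ψ) + Eslot 𝕂 n i 1 ψ

/-- `Δ(F_i) = F_i ⊗ 1 + K_i⁻¹ ⊗ F_i`. -/
def coprodF (i : Fin n) (ψ : MS 𝕂 n) : MS 𝕂 n :=
  Fslot 𝕂 n i 0 ψ + Kinvslot 𝕂 q n i 0 (Fslot 𝕂 n i 1 ψ)

/-- `Δ(K_i) = K_i ⊗ K_i`. -/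
def coprodK (i : Fin n) (ψ : MS 𝕂 n) : MS 𝕂 n :=
  Kslot 𝕂 q n i 0 (Kslot 𝕂 q n i 1 ψ)

lemma sSwap_zvar (r : Fin 2) : sSwap 𝕂 (zvar 𝕂 r) = zvar 𝕂 (Equiv.swap 0 1 r) := by
  simp [sSwap, zvar]

lemma sSwap_qK : sSwap 𝕂 (qK 𝕂 q) = qK 𝕂 q := by
  simp [sSwap, qK]

lemma zvar_ne_zero (r : Fin 2) : zvar 𝕂 r ≠ 0 := by
  simp [zvar]

lemma zvar_sub_ne_zero : zvar 𝕂 0 - zvar 𝕂 1 ≠ 0 := by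
  rw [sub_ne_zero]
  intro h
  have := X_injective (IsFractionRing.injective (MvPolynomial (Fin 2) 𝕂) (KF 𝕂) h)
  exact absurd this (by decide)

variable {q} in
lemma qK_ne_zero (hq : q ≠ 0) : qK 𝕂 q ≠ 0 := by
  simpa [qK] using hq

lemma cons_comp_swap {α : Type*} (a b : α) :
    (![a, b] : Fin 2 → α) ∘ Equiv.swap (0 : Fin 2) 1 = ![b, a] := by
  ext r; fin_cases r <;> simp

lemma update_cons_zero {α : Type*} (a b c : α) :
    Function.update (![a, b] : Fin 2 → α) 0 c = ![c, b] := by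
  ext r; fin_cases r <;> simp

lemma update_cons_one {α : Type*} (a b c : α) :
    Function.update (![a, b] : Fin 2 → α) 1 c = ![a, c] := by
  ext r; fin_cases r <;> simp

/-- The value of `T ψ` at the basis tensor indexed by `(a, b)`. -/
lemma heckeT_apply {N : ℕ} (ψ : MS 𝕂 N) (a b : Fin N) :
    heckeT 𝕂 q N ψ ![a, b] =
      if a < b then
        -(qK 𝕂 q * sSwap 𝕂 (ψ ![b, a])) - ((qK 𝕂 q) ^ 2 - 1) *
          ((zvar 𝕂 1 * sSwap 𝕂 (ψ ![a, b]) - zvar 𝕂 0 * ψ ![a, b]) / (zvar 𝕂 0 - zvar 𝕂 1))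
      else if a = b then
        -sSwap 𝕂 (ψ ![a, b]) - ((qK 𝕂 q) ^ 2 - 1) *
          (zvar 𝕂 0 * (sSwap 𝕂 (ψ ![a, b]) - ψ ![a, b]) / (zvar 𝕂 0 - zvar 𝕂 1))
      else
        -(qK 𝕂 q * sSwap 𝕂 (ψ ![b, a])) - ((qK 𝕂 q) ^ 2 - 1) *
          (zvar 𝕂 0 * (sSwap 𝕂 (ψ ![a, b]) - ψ ![a, b]) / (zvar 𝕂 0 - zvar 𝕂 1)) := by
  have hsum : heckeT 𝕂 q N ψ ![a, b] =
      ∑ x : Fin N, ∑ y : Fin N, heckeContrib 𝕂 q N ![x, y] (ψ ![x, y]) ![a, b] := by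
    rw [heckeT, Finset.sum_apply, ← (finTwoArrowEquiv (Fin N)).symm.sum_comp,
      Fintype.sum_prod_type]
    rfl
  have hcontrib : ∀ x y : Fin N, heckeContrib 𝕂 q N ![x, y] (ψ ![x, y]) ![a, b] =
      (if x = b then if y = a then
        (if x = y then 0 else -(qK 𝕂 q * sSwap 𝕂 (ψ ![x, y]))) else 0 else 0) +
      (if x = a then if y = b then
        (if x < y then -((qK 𝕂 q) ^ 2 - 1) *
          ((zvar 𝕂 1 * sSwap 𝕂 (ψ ![x, y]) - zvar 𝕂 0 * ψ ![x, y]) / (zvar 𝕂 0 - zvar 𝕂 1))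
        else (if x = y then -sSwap 𝕂 (ψ ![x, y]) else 0) - ((qK 𝕂 q) ^ 2 - 1) *
          (zvar 𝕂 0 * (sSwap 𝕂 (ψ ![x, y]) - ψ ![x, y]) / (zvar 𝕂 0 - zvar 𝕂 1)))
        else 0 else 0) := by
    intro x y
    have hvec : ∀ c d e f : Fin N, (![c, d] : Fin 2 → Fin N) = ![e, f] ↔ c = e ∧ d = f := by
      intro c d e f; simp
    simp only [heckeContrib, cons_comp_swap, Matrix.cons_val_zero, Matrix.cons_val_one]
    rcases lt_trichotomy x y with h | h | h
    · simp only [h, h.ne, if_true, if_false, Pi.sub_apply, Pi.smul_apply, Pi.single_apply, hvec,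
        smul_eq_mul]
      grind
    · simp only [h, lt_irrefl, if_true, if_false, Pi.sub_apply, Pi.smul_apply, Pi.neg_apply,
        Pi.single_apply, hvec, smul_eq_mul]
      grind
    · simp only [h.not_gt, h.ne', if_false, Pi.sub_apply, Pi.smul_apply, Pi.single_apply, hvec,
        smul_eq_mul]
      grind
  rw [hsum]
  simp only [hcontrib, Finset.sum_add_distrib, Finset.sum_ite_irrel, Finset.sum_const_zero,
    Finset.sum_ite_eq', Finset.mem_univ, if_true]
  rcases lt_trichotomy a b with h | h | h
  · simp [h, h.ne']; ring
  · simp [h]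
  · simp [h.not_gt, h.ne, h.ne']; ring

variable {n} in
/-- Relative position of `x`, `i - 1` and `i` in `Fin n`, where `i - 1` is cyclic. -/
lemma Fin.cyclic_pred_cases (hn : 2 ≤ n) (i : Fin n) :
    (i = 0 ∧ i < i - 1 ∧ ∀ x, x = i - 1 ∨ x = i ∨ (i < x ∧ x < i - 1)) ∨
      (i ≠ 0 ∧ i - 1 < i ∧
        ∀ x, x = i - 1 ∨ x = i ∨ (x < i - 1 ∧ x < i) ∨ (i - 1 < x ∧ i < x)) := by
  obtain ⟨k, rfl⟩ : ∃ k, n = k + 2 := ⟨n - 2, by omega⟩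
  by_cases hi : i = 0
  · subst hi
    have hl : ((0 : Fin (k + 2)) - 1) = Fin.last (k + 1) := by
      rw [sub_eq_iff_eq_add, Fin.last_add_one]
    rw [hl]
    refine Or.inl ⟨rfl, Fin.last_pos, fun x => ?_⟩
    rcases eq_or_ne x (Fin.last (k + 1)) with h | h
    · exact Or.inl h
    · rcases eq_or_ne x 0 with h0 | h0
      · exact Or.inr (Or.inl h0)
      · exact Or.inr (Or.inr ⟨Fin.pos_iff_ne_zero.2 h0, Fin.lt_last_iff_ne_last.2 h⟩)
  · have hv := Fin.val_sub_one_of_ne_zero hi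
    have h0 : (i : ℕ) ≠ 0 := fun h => hi (Fin.ext h)
    refine Or.inr ⟨hi, ?_, fun x => ?_⟩ <;>
      simp only [Fin.ext_iff, Fin.lt_def, hv] <;> omega

lemma coprodE_apply (i : Fin n) (ψ : MS 𝕂 n) (a b : Fin n) :
    coprodE 𝕂 q n i ψ ![a, b] =
      (if a = i - 1 then (if i = 0 then zvar 𝕂 0 else 1) *
        ((qK 𝕂 q) ^ (((if b = i - 1 then 1 else 0) - (if b = i then 1 else 0) : ℤ)) *
          ψ ![i, b]) else 0) +
      (if b = i - 1 then (if i = 0 then zvar 𝕂 1 else 1) * ψ ![a, i] else 0) := by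
  simp only [coprodE, Eslot, Kslot, Pi.add_apply, update_cons_zero,
    update_cons_one, Matrix.cons_val_zero, Matrix.cons_val_one]
  have h : ∀ x : Fin n, x = i - 1 → x + 1 = i := by rintro _ rfl; exact sub_add_cancel i 1
  grind

lemma coprodF_apply (i : Fin n) (ψ : MS 𝕂 n) (a b : Fin n) :
    coprodF 𝕂 q n i ψ ![a, b] =
      (if a = i then (if i = 0 then (zvar 𝕂 0)⁻¹ else 1) * ψ ![i - 1, b] else 0) +
      (qK 𝕂 q) ^ (-((if a = i - 1 then 1 else 0) - (if a = i then 1 else 0) : ℤ)) *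
      (if b = i then (if i = 0 then (zvar 𝕂 1)⁻¹ else 1) * ψ ![a, i - 1] else 0) := by
  simp only [coprodF, Fslot, Kinvslot, Pi.add_apply, update_cons_zero,
    update_cons_one, Matrix.cons_val_zero, Matrix.cons_val_one]
  grind

lemma coprodK_apply (i : Fin n) (ψ : MS 𝕂 n) (a b : Fin n) :
    coprodK 𝕂 q n i ψ ![a, b] =
      (qK 𝕂 q) ^ (((if a = i - 1 then 1 else 0) - (if a = i then 1 else 0) : ℤ)) *
      ((qK 𝕂 q) ^ (((if b = i - 1 then 1 else 0) - (if b = i then 1 else 0) : ℤ)) *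
        ψ ![a, b]) := by
  rfl

set_option maxHeartbeats 4000000 in
theorem heckeT_commutes_with_coproduct (hn : 2 ≤ n) (hq : q ≠ 0) (i : Fin n) :
    (∀ ψ : MS 𝕂 n, heckeT 𝕂 q n (coprodE 𝕂 q n i ψ) = coprodE 𝕂 q n i (heckeT 𝕂 q n ψ)) ∧
    (∀ ψ : MS 𝕂 n, heckeT 𝕂 q n (coprodF 𝕂 q n i ψ) = coprodF 𝕂 q n i (heckeT 𝕂 q n ψ)) ∧
    (∀ ψ : MS 𝕂 n, heckeT 𝕂 q n (coprodK 𝕂 q n i ψ) = coprodK 𝕂 q n i (heckeT 𝕂 q n ψ)) := by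
  have hz := zvar_sub_ne_zero 𝕂
  have hz' : zvar 𝕂 1 - zvar 𝕂 0 ≠ 0 := by rwa [← neg_sub, neg_ne_zero]
  have hz0 := zvar_ne_zero 𝕂 0
  have hz1 := zvar_ne_zero 𝕂 1
  have hQ := qK_ne_zero 𝕂 hq
  have hsq := sSwap_qK 𝕂 q
  have hs0 : sSwap 𝕂 (zvar 𝕂 0) = zvar 𝕂 1 := by simp [sSwap_zvar]
  have hs1 : sSwap 𝕂 (zvar 𝕂 1) = zvar 𝕂 0 := by simp [sSwap_zvar]
  have hord := Fin.cyclic_pred_cases hn i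
  have hvec : ∀ m : Fin 2 → Fin n, ∃ a b, m = ![a, b] := fun m =>
    ⟨m 0, m 1, by ext r; fin_cases r <;> rfl⟩
  refine ⟨fun ψ => ?_, fun ψ => ?_, fun ψ => ?_⟩ <;> ext m <;> obtain ⟨a, b, rfl⟩ := hvec m <;>
    simp only [heckeT_apply, coprodE_apply, coprodF_apply, coprodK_apply]
  all_goals
    generalize i - 1 = j at *
    rcases hord with ⟨rfl, hlt, hx⟩ | ⟨hi, hlt, hx⟩
    · rcases hx a with rfl | rfl | ⟨ha, ha'⟩ <;> rcases hx b with rfl | rfl | ⟨hb, hb'⟩ <;>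
        clear hx hvec <;> simp [*, LT.lt.not_gt, LT.lt.ne, LT.lt.ne'] <;>
        field_simp <;> ring
    · rcases hx a with rfl | rfl | ⟨ha, ha'⟩ | ⟨ha, ha'⟩ <;>
        rcases hx b with rfl | rfl | ⟨hb, hb'⟩ | ⟨hb, hb'⟩ <;>
        clear hx hvec <;> simp [*, LT.lt.not_gt, LT.lt.ne, LT.lt.ne'] <;>
        try field_simp
      all_goals try ring

end
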